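/- arXiv:0810.3019 — 2 statements merged into one kernel-verified Lean document; each statement's English description precedes it below -/
import Mathlib

section
/- Let c ≥ 1, d ≥ 1 be integers and a_1,…,a_d ≥ 2 be integers. Define real numbers Γ_0,…,Γ_d by the recurrence Γ_0 = 1 and Γ_j = Γ_{j−1} · (Γ_{j−1} − c^{2^{j−1}}/(a_j − 1)). If Γ_1,…,Γ_d are all positive, then the grid [a_1,…,a_d] is c-guaranteed. -/
/-- A point of the grid `[a 0, …, a (d-1)]`: one coordinate in `Fin (a i)` for each `i`. -/
def GridPoint (d : ℕ) (a : Fin d → ℕ) : Type := (i : Fin d) → Fin (a i)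

/-- A pair `p = (b, c)` with `b i < c i` for all `i` represents a (combinatorial) box
`∏ i, {b i, c i}`; it is a monochromatic box for the coloring `f` if `f` is constant
on the `2^d` points of the box. -/
def IsMonoBox {d : ℕ} {a : Fin d → ℕ} {c : ℕ} (f : GridPoint d a → Fin c)
    (p : GridPoint d a × GridPoint d a) : Prop :=
  (∀ i, p.1 i < p.2 i) ∧
    ∃ s : Fin c, ∀ x : GridPoint d a, (∀ i, x i = p.1 i ∨ x i = p.2 i) → f x = s

/-- The set of monochromatic boxes of a coloring `f` (each box represented uniquely
by the pair of its coordinatewise-minimal and coordinatewise-maximal corners). -/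
def monoBoxSet {d : ℕ} {a : Fin d → ℕ} {c : ℕ} (f : GridPoint d a → Fin c) :
    Set (GridPoint d a × GridPoint d a) := {p | IsMonoBox f p}

/-- The grid `[a 0, …, a (d-1)]` is `(c,t)`-guaranteed: every `c`-coloring admits at
least `t` distinct monochromatic boxes.  `c`-guaranteed means `(c,1)`-guaranteed. -/
def Guaranteed (d : ℕ) (a : Fin d → ℕ) (c t : ℕ) : Prop :=
  ∀ f : GridPoint d a → Fin c, t ≤ (monoBoxSet f).ncard

/-- The increasing pairs of elements of a finite set. -/
def ltPairs {α : Type*} [LinearOrder α] (S : Finset α) : Finset (α × α) :=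
  {q ∈ S ×ˢ S | q.1 < q.2}

theorem mem_ltPairs {α : Type*} [LinearOrder α] {S : Finset α} {q : α × α} :
    q ∈ ltPairs S ↔ (q.1 ∈ S ∧ q.2 ∈ S) ∧ q.1 < q.2 := by
  simp [ltPairs]

theorem two_mul_card_ltPairs {α : Type*} [LinearOrder α] (S : Finset α) :
    2 * ((ltPairs S).card : ℝ) = (S.card : ℝ) ^ 2 - S.card := by
  have hswap : (S.offDiag.filter fun q => ¬ q.1 < q.2).card = (ltPairs S).card := by
    refine Finset.card_bij' (fun q _ => q.swap) (fun q _ => q.swap) ?_ ?_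
      (fun _ _ => rfl) (fun _ _ => rfl)
    · intro q hq
      simp only [Finset.mem_filter, Finset.mem_offDiag, mem_ltPairs, Prod.fst_swap,
        Prod.snd_swap] at hq ⊢
      exact ⟨⟨hq.1.2.1, hq.1.1⟩, lt_of_le_of_ne (not_lt.1 hq.2) (Ne.symm hq.1.2.2)⟩
    · intro q hq
      simp only [Finset.mem_filter, Finset.mem_offDiag, mem_ltPairs, Prod.fst_swap,
        Prod.snd_swap] at hq ⊢
      exact ⟨⟨hq.1.2, hq.1.1, hq.2.ne'⟩, hq.2.not_gt⟩
  have hlt : S.offDiag.filter (fun q => q.1 < q.2) = ltPairs S := by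
    ext q
    simp only [Finset.mem_filter, Finset.mem_offDiag, mem_ltPairs]
    exact ⟨fun h => ⟨⟨h.1.1, h.1.2.1⟩, h.2⟩, fun h => ⟨⟨h.1.1, h.1.2, h.2.ne⟩, h.2⟩⟩
  have h := Finset.card_filter_add_card_filter_not (s := S.offDiag) fun q => q.1 < q.2
  rw [hswap, hlt, Finset.offDiag_card] at h
  have hle : S.card ≤ S.card * S.card := Nat.le_mul_self _
  have h' : ((ltPairs S).card : ℝ) + (ltPairs S).card = S.card * S.card - S.card := by
    rw [← Nat.cast_mul, ← Nat.cast_sub hle, ← h, Nat.cast_add]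
  linarith

/-- Double counting of increasing pairs: if the sets `T k` are subsets of `U` of average size at
least a proportion `l / |α|` of `M ≥ |U|`, many increasing pairs `k < k'` share elements. -/
theorem mul_sub_le_two_mul_sum_card_ltPairs {α β : Type*} [Fintype α] [LinearOrder α]
    [DecidableEq β] (U : Finset β) (T : α → Finset β) (hT : ∀ k, T k ⊆ U) {M l : ℝ}
    (hU : (U.card : ℝ) ≤ M) (hl : 1 ≤ l) (hS : l * M ≤ ∑ k, ((T k).card : ℝ)) :
    M * (l ^ 2 - l) ≤
      2 * ∑ e ∈ U, ((ltPairs (Finset.univ.filter fun k => e ∈ T k)).card : ℝ) := by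
  have hsum : ∑ e ∈ U, ((Finset.univ.filter fun k => e ∈ T k).card : ℝ) =
      ∑ k, ((T k).card : ℝ) := by
    have h := Finset.sum_card_bipartiteAbove_eq_sum_card_bipartiteBelow
      (s := U) (t := (Finset.univ : Finset α)) fun e k => e ∈ T k
    have hb : ∀ k, Finset.bipartiteBelow (fun e k => e ∈ T k) U k = T k := fun k => by
      ext e
      simpa [Finset.bipartiteBelow] using @hT k e
    simp only [hb, Finset.bipartiteAbove] at h
    exact_mod_cast h
  have htangent : (2 * l - 1) * ∑ k, ((T k).card : ℝ) - U.card * l ^ 2 ≤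
      2 * ∑ e ∈ U, ((ltPairs (Finset.univ.filter fun k => e ∈ T k)).card : ℝ) := by
    rw [← hsum, Finset.mul_sum, Finset.mul_sum, ← nsmul_eq_mul, ← Finset.sum_const,
      ← Finset.sum_sub_distrib]
    refine Finset.sum_le_sum fun e _ => ?_
    rw [two_mul_card_ltPairs]
    nlinarith [sq_nonneg (((Finset.univ.filter fun k => e ∈ T k).card : ℝ) - l)]
  have h1 := mul_le_mul_of_nonneg_left hS (by linarith : (0 : ℝ) ≤ 2 * l - 1)
  have h2 := mul_le_mul_of_nonneg_right hU (sq_nonneg l)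
  nlinarith

instance GridPoint.instFintype (d : ℕ) (a : Fin d → ℕ) : Fintype (GridPoint d a) :=
  inferInstanceAs (Fintype ((i : Fin d) → Fin (a i)))

/-- The boxes of the grid, each paired with every color. -/
noncomputable def coloredBoxes (d : ℕ) (a : Fin d → ℕ) (c : ℕ) :
    Finset ((GridPoint d a × GridPoint d a) × Fin c) :=
  open Classical in {e | ∀ i, e.1.1 i < e.1.2 i}

/-- The monochromatic boxes of a coloring, each paired with its color. -/
noncomputable def monoColoredBoxes {d : ℕ} {a : Fin d → ℕ} {c : ℕ}
    (f : GridPoint d a → Fin c) : Finset ((GridPoint d a × GridPoint d a) × Fin c) :=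
  open Classical in {e | (∀ i, e.1.1 i < e.1.2 i) ∧
    ∀ x : GridPoint d a, (∀ i, x i = e.1.1 i ∨ x i = e.1.2 i) → f x = e.2}

theorem monoColoredBoxes_subset {d : ℕ} {a : Fin d → ℕ} {c : ℕ}
    (f : GridPoint d a → Fin c) : monoColoredBoxes f ⊆ coloredBoxes d a c := fun e he => by
  simp only [monoColoredBoxes, coloredBoxes, Finset.mem_filter] at he ⊢
  exact ⟨he.1, he.2.1⟩

theorem card_coloredBoxes_le (d : ℕ) (a : Fin d → ℕ) (c : ℕ) :
    (coloredBoxes d a c).card ≤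
      (∏ i, (ltPairs (Finset.univ : Finset (Fin (a i)))).card) * c := by
  classical
  have h : (coloredBoxes d a c).card ≤
      ((Fintype.piFinset fun i => ltPairs (Finset.univ : Finset (Fin (a i)))) ×ˢ
        (Finset.univ : Finset (Fin c))).card := by
    refine Finset.card_le_card_of_injOn (fun e => (fun i => (e.1.1 i, e.1.2 i), e.2)) ?_ ?_
    · intro e he
      simp only [coloredBoxes, Finset.mem_coe, Finset.mem_filter] at he
      simpa [mem_ltPairs] using he.2
    · rintro ⟨⟨x, y⟩, s⟩ _ ⟨⟨x', y'⟩, s'⟩ _ h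
      simp only [Prod.mk.injEq] at h
      have hx : x = x' := funext fun i => congrArg Prod.fst (congrFun h.1 i)
      have hy : y = y' := funext fun i => congrArg Prod.snd (congrFun h.1 i)
      rw [hx, hy, h.2]
  simpa [Finset.card_product, Fintype.card_piFinset] using h

/-- Append a last coordinate to a grid point. -/
def GridPoint.snoc {d : ℕ} {a : Fin (d + 1) → ℕ} (x : GridPoint d fun i => a i.castSucc)
    (k : Fin (a (Fin.last d))) : GridPoint (d + 1) a :=
  Fin.snoc (α := fun i => Fin (a i)) x k

theorem GridPoint.snoc_castSucc {d : ℕ} {a : Fin (d + 1) → ℕ}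
    (x : GridPoint d fun i => a i.castSucc) (k : Fin (a (Fin.last d))) (i : Fin d) :
    GridPoint.snoc x k i.castSucc = x i :=
  Fin.snoc_castSucc (α := fun i => Fin (a i)) _ _ _

theorem GridPoint.snoc_last {d : ℕ} {a : Fin (d + 1) → ℕ}
    (x : GridPoint d fun i => a i.castSucc) (k : Fin (a (Fin.last d))) :
    GridPoint.snoc x k (Fin.last d) = k :=
  Fin.snoc_last (α := fun i => Fin (a i)) _ _

theorem GridPoint.snoc_inj {d : ℕ} {a : Fin (d + 1) → ℕ}
    {x y : GridPoint d fun i => a i.castSucc} {k l : Fin (a (Fin.last d))}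
    (h : GridPoint.snoc x k = GridPoint.snoc y l) : x = y ∧ k = l := by
  refine ⟨funext fun i => ?_, ?_⟩
  · rw [← snoc_castSucc x k, h, snoc_castSucc]
  · rw [← snoc_last x k, h, snoc_last]

theorem GridPoint.snoc_init {d : ℕ} {a : Fin (d + 1) → ℕ} (x : GridPoint (d + 1) a) :
    GridPoint.snoc (fun i => x i.castSucc) (x (Fin.last d)) = x :=
  Fin.snoc_init_self (α := fun i => Fin (a i)) x

open Classical in
/-- Two monochromatic boxes with equal base and color in two slices span a monochromatic box. -/
theorem sum_card_ltPairs_le_card_monoColoredBoxes {d : ℕ} {a : Fin (d + 1) → ℕ} {c : ℕ}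
    (f : GridPoint (d + 1) a → Fin c) :
    ∑ e ∈ coloredBoxes d (fun i => a i.castSucc) c,
      (ltPairs (Finset.univ.filter fun k : Fin (a (Fin.last d)) =>
        e ∈ monoColoredBoxes fun x => f (GridPoint.snoc x k))).card ≤
      (monoColoredBoxes f).card := by
  rw [← Finset.card_sigma]
  refine Finset.card_le_card_of_injOn
    (fun z => ((GridPoint.snoc z.1.1.1 z.2.1, GridPoint.snoc z.1.1.2 z.2.2), z.1.2)) ?_ ?_
  · rintro ⟨⟨⟨x, y⟩, s⟩, k, l⟩ hz
    simp only [Finset.coe_sigma, Set.mem_sigma_iff, Finset.mem_coe, mem_ltPairs,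
      monoColoredBoxes, Finset.mem_filter, Finset.mem_univ, true_and] at hz ⊢
    obtain ⟨-, ⟨⟨hxy, hk⟩, -, hl⟩, hkl⟩ := hz
    refine ⟨fun i => ?_, fun w hw => ?_⟩
    · refine Fin.lastCases ?_ (fun i => ?_) i
      · simpa only [GridPoint.snoc_last] using hkl
      · simpa only [GridPoint.snoc_castSucc] using hxy i
    · have hinit : ∀ i : Fin d, w i.castSucc = x i ∨ w i.castSucc = y i := fun i => by
        simpa only [GridPoint.snoc_castSucc] using hw i.castSucc
      have hlast := hw (Fin.last d)
      simp only [GridPoint.snoc_last] at hlast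
      rw [← GridPoint.snoc_init w]
      rcases hlast with h | h <;> rw [h]
      · exact hk _ hinit
      · exact hl _ hinit
  · rintro ⟨⟨⟨x, y⟩, s⟩, k, l⟩ _ ⟨⟨⟨x', y'⟩, s'⟩, k', l'⟩ _ h
    simp only [Prod.mk.injEq] at h
    obtain ⟨⟨hx, hy⟩, rfl⟩ := h
    obtain ⟨rfl, rfl⟩ := GridPoint.snoc_inj hx
    obtain ⟨rfl, rfl⟩ := GridPoint.snoc_inj hy
    rfl

/-- Adding a dimension of size `A` multiplies the lower bound for the number of monochromatic
boxes by `C(A, 2)` and turns the density `G` into `G * (G - q / (A - 1))`. -/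
theorem gamma_step {A G q M C K : ℝ} (hA : 0 < A - 1) (hG : 0 ≤ G) (hq : 0 < q)
    (hM : 0 ≤ M) (hC : 2 * C = A ^ 2 - A)
    (hK : M * ((A * G / q) ^ 2 - A * G / q) ≤ 2 * K) :
    G * (G - q / (A - 1)) * (M * C) ≤ q ^ 2 * K := by
  have hA0 : 0 ≤ A := by linarith
  have hdiv : q / (A - 1) * (A ^ 2 - A) = q * A := by
    rw [div_mul_eq_mul_div, div_eq_iff hA.ne']
    ring
  have hGC : 2 * (G * (G - q / (A - 1)) * C) = A * G * (G * (A - 1) - q) := by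
    linear_combination G * (G - q / (A - 1)) * hC - G * hdiv
  have hlq : q ^ 2 * ((A * G / q) ^ 2 - A * G / q) = A * G * (A * G - q) := by
    field_simp
  have hb := mul_le_mul_of_nonneg_left hK (sq_nonneg q)
  rw [mul_left_comm, hlq] at hb
  have hcmp : A * G * (G * (A - 1) - q) ≤ A * G * (A * G - q) :=
    mul_le_mul_of_nonneg_left (by linarith) (by positivity)
  rw [← hGC] at hcmp
  linarith [mul_le_mul_of_nonneg_left hcmp hM]

/-- `Γ_d ∏ C(a_i, 2) / c ^ (2 ^ d - 1)` is a lower bound for the number of monochromatic boxes. -/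
theorem gamma_mul_le_card_monoColoredBoxes {c : ℕ} (hc : 1 ≤ c) (Γ : ℕ → ℝ) (h0 : Γ 0 = 1)
    (d : ℕ) (a : Fin d → ℕ) (ha : ∀ i, 2 ≤ a i)
    (hrec : ∀ j : Fin d, Γ ((j : ℕ) + 1) =
      Γ (j : ℕ) * (Γ (j : ℕ) - (c : ℝ) ^ (2 ^ (j : ℕ)) / ((a j : ℝ) - 1)))
    (hpos : ∀ j : Fin d, 0 < Γ ((j : ℕ) + 1)) (f : GridPoint d a → Fin c) :
    0 < Γ d ∧
      Γ d * ((∏ i, ((ltPairs (Finset.univ : Finset (Fin (a i)))).card : ℝ)) * c) ≤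
        (c : ℝ) ^ (2 ^ d) * (monoColoredBoxes f).card := by
  classical
  induction d with
  | zero =>
    have hne : (monoColoredBoxes f).Nonempty := by
      let o : GridPoint 0 a := fun i => i.elim0
      refine ⟨((o, o), f o), ?_⟩
      simp only [monoColoredBoxes, Finset.mem_filter, Finset.mem_univ, true_and]
      exact ⟨fun i => i.elim0, fun x _ => congrArg f (funext fun i => i.elim0)⟩
    have hcard : (1 : ℝ) ≤ (monoColoredBoxes f).card := by exact_mod_cast hne.card_pos
    simp only [h0, Finset.univ_eq_empty, Finset.prod_empty, pow_zero, pow_one, one_mul, zero_lt_one,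
      true_and]
    exact le_mul_of_one_le_right c.cast_nonneg hcard
  | succ d ih =>
    have hslice := fun k : Fin (a (Fin.last d)) => ih (fun i => a i.castSucc)
      (fun i => ha _) (fun j => hrec j.castSucc) (fun j => hpos j.castSucc)
      (fun x => f (GridPoint.snoc x k))
    have hA : (2 : ℝ) ≤ a (Fin.last d) := by exact_mod_cast ha (Fin.last d)
    have hG := (hslice ⟨0, by have := ha (Fin.last d); omega⟩).1
    have hG' := hpos (Fin.last d)
    have hr := hrec (Fin.last d)
    simp only [Fin.val_last] at hG' hr
    refine ⟨hG', ?_⟩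
    have hU := card_coloredBoxes_le d (fun i => a i.castSucc) c
    rw [← Nat.cast_le (α := ℝ), Nat.cast_mul, Nat.cast_prod] at hU
    have hK := sum_card_ltPairs_le_card_monoColoredBoxes f
    rw [← Nat.cast_le (α := ℝ), Nat.cast_sum] at hK
    have hC := two_mul_card_ltPairs (Finset.univ : Finset (Fin (a (Fin.last d))))
    rw [Finset.card_fin] at hC
    rw [Fin.prod_univ_castSucc]
    have hq : (0 : ℝ) < (c : ℝ) ^ 2 ^ d := by
      have : (0 : ℝ) < c := by exact_mod_cast hc
      positivity
    have hq2 : (c : ℝ) ^ 2 ^ (d + 1) = ((c : ℝ) ^ 2 ^ d) ^ 2 := by rw [pow_succ 2 d, pow_mul]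
    rw [hq2]
    set q := (c : ℝ) ^ 2 ^ d
    set G := Γ d
    set A := (a (Fin.last d) : ℝ)
    set P := ∏ i : Fin d, ((ltPairs (Finset.univ : Finset (Fin (a i.castSucc)))).card : ℝ)
    set C := ((ltPairs (Finset.univ : Finset (Fin (a (Fin.last d))))).card : ℝ)
    have hM : 0 ≤ P * c :=
      mul_nonneg (Finset.prod_nonneg fun _ _ => Nat.cast_nonneg _) c.cast_nonneg
    have hA1 : 0 < A - 1 := by linarith
    have hGq : q < G * (A - 1) := by
      rw [hr] at hG'
      have := (mul_pos_iff_of_pos_left hG).1 hG'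
      rwa [sub_pos, div_lt_iff₀ hA1] at this
    have hl : 1 ≤ A * G / q := by
      rw [one_le_div hq]
      nlinarith
    have hS : A * G / q * (P * c) ≤ ∑ k : Fin (a (Fin.last d)),
        ((monoColoredBoxes fun x => f (GridPoint.snoc x k)).card : ℝ) := by
      have h := Finset.sum_le_sum fun k (_ : k ∈ (Finset.univ : Finset (Fin (a (Fin.last d))))) =>
        (hslice k).2
      rw [Finset.sum_const, Finset.card_fin, nsmul_eq_mul, ← Finset.mul_sum] at h
      rw [div_mul_eq_mul_div, div_le_iff₀ hq]
      linarith
    have hmain := mul_sub_le_two_mul_sum_card_ltPairs _ _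
      (fun k : Fin (a (Fin.last d)) => monoColoredBoxes_subset
        fun x => f (GridPoint.snoc x k)) hU hl hS
    have hbound : P * c * ((A * G / q) ^ 2 - A * G / q) ≤ 2 * (monoColoredBoxes f).card :=
      hmain.trans (by linarith)
    rw [hr, mul_right_comm P C]
    exact gamma_step hA1 hG.le hq hM hC hbound

/-- with `Γ_0 = 1` and `Γ_j = Γ_{j-1} (Γ_{j-1} - c^(2^(j-1))/(a_j - 1))`,
if `Γ_1, …, Γ_d > 0` then `[a_1,…,a_d]` is `c`-guaranteed. -/
theorem gamma_guaranteed (c d : ℕ) (hc : 1 ≤ c) (hd : 1 ≤ d)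
    (a : Fin d → ℕ) (ha : ∀ i, 2 ≤ a i)
    (Γ : ℕ → ℝ) (h0 : Γ 0 = 1)
    (hrec : ∀ j : Fin d, Γ ((j : ℕ) + 1) =
      Γ (j : ℕ) * (Γ (j : ℕ) - (c : ℝ) ^ (2 ^ (j : ℕ)) / ((a j : ℝ) - 1)))
    (hpos : ∀ j : Fin d, 0 < Γ ((j : ℕ) + 1)) :
    Guaranteed d a c 1 := by
  intro f
  obtain ⟨hG, hle⟩ := gamma_mul_le_card_monoColoredBoxes hc Γ h0 d a ha hrec hpos f
  have hc0 : (0 : ℝ) < c := by exact_mod_cast hc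
  have hN : (0 : ℝ) < ∏ i, ((ltPairs (Finset.univ : Finset (Fin (a i)))).card : ℝ) := by
    refine Finset.prod_pos fun i _ => ?_
    have h := two_mul_card_ltPairs (Finset.univ : Finset (Fin (a i)))
    rw [Finset.card_fin] at h
    have hi : (2 : ℝ) ≤ a i := by exact_mod_cast ha i
    nlinarith
  have hcard : (0 : ℝ) < (monoColoredBoxes f).card :=
    pos_of_mul_pos_right ((mul_pos hG (mul_pos hN hc0)).trans_le hle) (by positivity)
  obtain ⟨e, he⟩ := Finset.card_pos.1 (Nat.cast_pos.1 hcard)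
  simp only [monoColoredBoxes, Finset.mem_filter, Finset.mem_univ, true_and] at he
  have hmono : (monoBoxSet f).Nonempty := ⟨e.1, he.1, e.2, he.2⟩
  exact (Set.ncard_pos (Set.toFinite _)).2 hmono
end

section
/- Let c ≥ 1, d ≥ 1 be integers and a_1,…,a_d ≥ 2 be integers. Define real numbers ε_0,…,ε_d by the recurrence ε_0 = 0 and ε_j = 2ε_{j−1} + c^{2^{j−1}}/(a_j − 1). If ε_d < 1, then the grid [a_1,…,a_d] is c-guaranteed. -/
/-- The increasing pairs of elements of `Fin n`: the one-dimensional boxes. -/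
abbrev IncPair (n : ℕ) : Type := {e : Fin n × Fin n // e.1 < e.2}

/-- All `2^d` points of the box `b` have color `s`. -/
def HasColor {d c : ℕ} {a : Fin d → ℕ} (f : GridPoint d a → Fin c)
    (b : ∀ i, IncPair (a i)) (s : Fin c) : Prop :=
  ∀ x : GridPoint d a, (∀ i, x i = (b i).1.1 ∨ x i = (b i).1.2) → f x = s

open Classical in
/-- The number of pairs of a box and a color such that the box has that color. -/
noncomputable def coloredBoxCount {d c : ℕ} {a : Fin d → ℕ} (f : GridPoint d a → Fin c) : ℕ :=
  (Finset.univ.filter fun p : (∀ i, IncPair (a i)) × Fin c => HasColor f p.1 p.2).card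

/-- The slice of a coloring at a given value of the last coordinate. -/
def slice {d c : ℕ} {a : Fin (d + 1) → ℕ} (f : GridPoint (d + 1) a → Fin c)
    (i : Fin (a (Fin.last d))) : GridPoint d (fun j => a j.castSucc) → Fin c :=
  fun x => f (Fin.snoc (α := fun j => Fin (a j)) x i)

lemma two_mul_card_incPair_filter {n : ℕ} (S : Finset (Fin n)) :
    (2 : ℝ) * (Finset.univ.filter fun e : IncPair n => e.1.1 ∈ S ∧ e.1.2 ∈ S).card
      = S.card * (S.card - 1) := by
  have hsub : (Finset.univ.filter fun e : IncPair n => e.1.1 ∈ S ∧ e.1.2 ∈ S).card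
      = (S.offDiag.filter fun e => e.1 < e.2).card := by
    refine Finset.card_bij (fun e _ => e.1) ?_ ?_ ?_
    · rintro ⟨e, he⟩ h
      simp only [Finset.mem_filter, Finset.mem_univ, true_and] at h
      simp [h, he, he.ne]
    · intro e _ e' _ h
      exact Subtype.ext h
    · intro e he
      simp only [Finset.mem_filter, Finset.mem_offDiag] at he
      exact ⟨⟨e, he.2⟩, by simp [he.1.1, he.1.2.1], rfl⟩
  have hswap : (S.offDiag.filter fun e => ¬ e.1 < e.2).card
      = (S.offDiag.filter fun e => e.1 < e.2).card := by
    refine Finset.card_bij (fun e _ => e.swap) ?_ ?_ ?_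
    · intro e he
      simp only [Finset.mem_filter, Finset.mem_offDiag, Prod.fst_swap, Prod.snd_swap] at he ⊢
      exact ⟨⟨he.1.2.1, he.1.1, he.1.2.2.symm⟩,
        lt_of_le_of_ne (not_lt.1 he.2) he.1.2.2.symm⟩
    · intro e _ e' _ h
      exact Prod.swap_injective h
    · intro e he
      simp only [Finset.mem_filter, Finset.mem_offDiag] at he
      refine ⟨e.swap, ?_, Prod.swap_swap e⟩
      simp [he.1.1, he.1.2.1, he.1.2.2.symm, he.2.le]
  have hsplit := Finset.card_filter_add_card_filter_not (s := S.offDiag) (fun e => e.1 < e.2)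
  have hoff := S.offDiag_card
  have hle : S.card ≤ S.card * S.card := Nat.le_mul_self _
  have key : 2 * (S.offDiag.filter fun e => e.1 < e.2).card + S.card = S.card * S.card := by
    omega
  have key' : (2 : ℝ) * (S.offDiag.filter fun e => e.1 < e.2).card + S.card
      = S.card * S.card := by
    exact_mod_cast key
  rw [hsub]
  linarith

lemma two_mul_card_incPair (n : ℕ) : (2 : ℝ) * Fintype.card (IncPair n) = n * (n - 1) := by
  simpa using two_mul_card_incPair_filter (Finset.univ : Finset (Fin n))

lemma HasColor.snoc {d c : ℕ} {a : Fin (d + 1) → ℕ} {f : GridPoint (d + 1) a → Fin c}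
    {b : ∀ i : Fin d, IncPair (a i.castSucc)} {s : Fin c} {e : IncPair (a (Fin.last d))}
    (h₁ : HasColor (slice f e.1.1) b s) (h₂ : HasColor (slice f e.1.2) b s) :
    HasColor f (Fin.snoc (α := fun i => IncPair (a i)) b e) s := by
  intro x hx
  have hinit : ∀ i : Fin d, x i.castSucc = (b i).1.1 ∨ x i.castSucc = (b i).1.2 := by
    intro i
    simpa using hx i.castSucc
  have hlast : x (Fin.last d) = e.1.1 ∨ x (Fin.last d) = e.1.2 := by
    simpa using hx (Fin.last d)
  have hslice : slice f (x (Fin.last d)) (fun i => x i.castSucc) = f x :=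
    congrArg f (Fin.snoc_init_self (α := fun j => Fin (a j)) x)
  rw [← hslice]
  rcases hlast with h | h <;> rw [h]
  · exact h₁ _ hinit
  · exact h₂ _ hinit

open Classical in
/-- The values of the last coordinate at which the slice of `f` gives color `s` to the box `b`. -/
noncomputable def coloredSlices {d c : ℕ} {a : Fin (d + 1) → ℕ} (f : GridPoint (d + 1) a → Fin c)
    (p : (∀ i : Fin d, IncPair (a i.castSucc)) × Fin c) : Finset (Fin (a (Fin.last d))) :=
  Finset.univ.filter fun i => HasColor (slice f i) p.1 p.2

lemma sum_card_coloredSlices {d c : ℕ} {a : Fin (d + 1) → ℕ} (f : GridPoint (d + 1) a → Fin c) :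
    ∑ p, (coloredSlices f p).card = ∑ i, coloredBoxCount (slice f i) := by
  simp only [coloredSlices, coloredBoxCount, Finset.card_filter]
  exact Finset.sum_comm

lemma sum_card_incPair_le_coloredBoxCount {d c : ℕ} {a : Fin (d + 1) → ℕ}
    (f : GridPoint (d + 1) a → Fin c) :
    ∑ p, (Finset.univ.filter fun e : IncPair (a (Fin.last d)) =>
      e.1.1 ∈ coloredSlices f p ∧ e.1.2 ∈ coloredSlices f p).card ≤ coloredBoxCount f := by
  classical
  rw [← Finset.card_sigma, coloredBoxCount]
  refine Finset.card_le_card_of_injOn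
    (fun q => (Fin.snoc (α := fun i => IncPair (a i)) q.1.1 q.2, q.1.2)) ?_ ?_
  · rintro ⟨⟨b, s⟩, e⟩ h
    simp only [coloredSlices, Finset.coe_sigma, Set.mem_sigma_iff, Finset.coe_filter,
      Finset.mem_filter, Finset.mem_univ, true_and, Set.mem_ofPred_eq, Finset.coe_univ,
      Set.mem_univ] at h ⊢
    exact h.1.snoc h.2
  · rintro ⟨⟨b, s⟩, e⟩ - ⟨⟨b', s'⟩, e'⟩ - h
    obtain ⟨h, rfl⟩ := Prod.mk.inj h
    obtain ⟨rfl, rfl⟩ := Fin.snoc_injective2 h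
    rfl

/-- Convexity of `n ↦ n (n - 1)`: if `N` numbers have average at least `x ≥ 1`, then
`∑ n (n - 1) ≥ N x (x - 1)`. -/
lemma mul_le_sum_mul_sub_one {ι : Type*} [Fintype ι] (n : ι → ℝ) {x : ℝ} (hx : 1 ≤ x)
    (h : Fintype.card ι * x ≤ ∑ i, n i) :
    Fintype.card ι * (x * (x - 1)) ≤ ∑ i, n i * (n i - 1) := by
  have htan : ∑ i, ((2 * x - 1) * n i - x ^ 2) ≤ ∑ i, n i * (n i - 1) :=
    Finset.sum_le_sum fun i _ => by nlinarith [sq_nonneg (n i - x)]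
  rw [Finset.sum_sub_distrib, ← Finset.mul_sum, Finset.sum_const, Finset.card_univ,
    nsmul_eq_mul] at htan
  nlinarith [mul_le_mul_of_nonneg_left h (by linarith : (0 : ℝ) ≤ 2 * x - 1)]

/-- Every coloring has at least a `1 - ε d` fraction of the expected number of monochromatic
boxes of a random coloring, stated without division. -/
lemma le_coloredBoxCount {c : ℕ} (hc : 1 ≤ c) (ε : ℕ → ℝ) (h0 : ε 0 = 0) (d : ℕ)
    (a : Fin d → ℕ) (ha : ∀ i, 2 ≤ a i)
    (hrec : ∀ j : Fin d, ε ((j : ℕ) + 1) =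
      2 * ε (j : ℕ) + (c : ℝ) ^ (2 ^ (j : ℕ)) / ((a j : ℝ) - 1))
    (f : GridPoint d a → Fin c) :
    0 ≤ ε d ∧ (1 - ε d) * (c * ∏ i, (Fintype.card (IncPair (a i)) : ℝ))
      ≤ (c : ℝ) ^ (2 ^ d) * coloredBoxCount f := by
  induction d with
  | zero =>
    refine ⟨h0.ge, ?_⟩
    have hpos : 1 ≤ coloredBoxCount f := by
      classical
      refine Finset.card_pos.2 ⟨(fun i => i.elim0, f fun i => i.elim0), ?_⟩
      simp only [Finset.mem_filter, Finset.mem_univ, true_and]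
      intro x _
      exact congrArg f (funext fun i => i.elim0)
    have hpos' : (1 : ℝ) ≤ coloredBoxCount f := by exact_mod_cast hpos
    have : (0 : ℝ) ≤ c := c.cast_nonneg
    simp only [h0, Finset.univ_eq_empty, Finset.prod_empty, pow_zero, pow_one]
    nlinarith
  | succ d ih =>
    have hεd := hrec (Fin.last d)
    have ih' := fun i => ih (fun j => a j.castSucc) (fun j => ha _)
      (fun j => hrec j.castSucc) (slice f i)
    have hlast := ha (Fin.last d)
    rw [Fin.prod_univ_castSucc]
    set T : ℝ := ∏ i : Fin d, (Fintype.card (IncPair (a i.castSucc)) : ℝ)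
    have hT0 : 0 ≤ T := Finset.prod_nonneg fun i _ => Nat.cast_nonneg _
    have hcard : (Fintype.card ((∀ i : Fin d, IncPair (a i.castSucc)) × Fin c) : ℝ) = T * c := by
      rw [Fintype.card_prod, Fintype.card_pi, Fintype.card_fin]
      push_cast
      rfl
    have hpair := two_mul_card_incPair (a (Fin.last d))
    have hsum := sum_card_coloredSlices f
    have hle := sum_card_incPair_le_coloredBoxCount f
    simp only [Fin.val_last] at hεd
    set n : ℝ := (a (Fin.last d) : ℝ) with hn
    set C : ℝ := (c : ℝ) ^ (2 ^ d) with hC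
    have hc' : (1 : ℝ) ≤ c := by exact_mod_cast hc
    have hn2 : (2 : ℝ) ≤ n := by rw [hn]; exact_mod_cast hlast
    have hC1 : 1 ≤ C := one_le_pow₀ hc'
    have hCC : (c : ℝ) ^ (2 ^ (d + 1)) = C * C := by rw [hC, ← pow_add]; congr 1; ring
    have hε0 : 0 ≤ ε d := (ih' ⟨0, by omega⟩).1
    have hq : 0 ≤ C / (n - 1) := div_nonneg (by linarith) (by linarith)
    refine ⟨by linarith, ?_⟩
    rw [hCC]
    set x : ℝ := n * (1 - ε d) / C with hx
    have hxC : x * C = n * (1 - ε d) := div_mul_cancel₀ _ (by linarith)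
    have hqn : C / (n - 1) * (n - 1) = C := div_mul_cancel₀ _ (by linarith)
    -- the new lower bound, multiplied by `n (n - 1)`, is at most `C² x (x - 1)`
    have hscalar : (1 - ε (d + 1)) * (n * (n - 1)) ≤ C * C * (x * (x - 1)) := by
      have h1 : C * C * (x * (x - 1)) = (n * (1 - ε d)) * (n * (1 - ε d) - C) := by
        rw [← hxC]; ring
      have h2 : (1 - ε (d + 1)) * (n * (n - 1))
          = n * ((1 - 2 * ε d) * (n - 1) - C) := by
        rw [hεd]; linear_combination (-n) * hqn
      rw [h1, h2, mul_assoc]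
      refine mul_le_mul_of_nonneg_left ?_ (by linarith)
      nlinarith [mul_nonneg hε0 (by linarith : 0 ≤ C), mul_nonneg (sq_nonneg (ε d))
        (by linarith : 0 ≤ n)]
    by_cases hx1 : 1 ≤ x
    · have htotal : (T * c) * x ≤ ∑ p, ((coloredSlices f p).card : ℝ) := by
        have h1 : ∑ p, ((coloredSlices f p).card : ℝ) = ∑ i, (coloredBoxCount (slice f i) : ℝ) := by
          exact_mod_cast hsum
        have h2 : ∑ _i : Fin (a (Fin.last d)), (1 - ε d) * (c * T)
            ≤ ∑ i, C * (coloredBoxCount (slice f i) : ℝ) :=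
          Finset.sum_le_sum fun i _ => (ih' i).2
        rw [Finset.sum_const, Finset.card_univ, Fintype.card_fin, nsmul_eq_mul,
          ← Finset.mul_sum, ← h1] at h2
        refine le_of_mul_le_mul_left ?_ (by linarith : 0 < C)
        calc C * (T * c * x) = n * ((1 - ε d) * (c * T)) := by
              linear_combination (T * c) * hxC
          _ ≤ _ := h2
      have hconv := mul_le_sum_mul_sub_one (fun p => ((coloredSlices f p).card : ℝ)) hx1
        (by rw [hcard]; exact htotal)
      rw [hcard] at hconv
      have hcount : ∑ p, ((coloredSlices f p).card : ℝ) * ((coloredSlices f p).card - 1)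
          ≤ 2 * coloredBoxCount f := by
        simp only [← two_mul_card_incPair_filter, ← Finset.mul_sum]
        have : (∑ p, ((Finset.univ.filter fun e : IncPair (a (Fin.last d)) =>
            e.1.1 ∈ coloredSlices f p ∧ e.1.2 ∈ coloredSlices f p).card : ℝ))
            ≤ coloredBoxCount f := by
          exact_mod_cast hle
        linarith
      have h1 := mul_le_mul_of_nonneg_left (hconv.trans hcount) (by positivity : 0 ≤ C * C)
      have h2 := mul_le_mul_of_nonneg_left hscalar (by positivity : 0 ≤ T * c)
      rw [← hpair] at h2
      linarith
    · have hneg : 1 - ε (d + 1) ≤ 0 := by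
        have hlt : n * (1 - ε d) ≤ C := by
          rw [← hxC]; nlinarith
        have : n * (1 - ε d) ≤ n * (C / (n - 1)) := by linarith
        have := le_of_mul_le_mul_left this (by linarith)
        linarith
      have hr : 0 ≤ C * C * (coloredBoxCount f : ℝ) := by positivity
      exact (mul_nonpos_of_nonpos_of_nonneg hneg (by positivity)).trans hr

/-- with `ε_0 = 0` and `ε_j = 2 ε_{j-1} + c^(2^(j-1))/(a_j - 1)`,
if `ε_d < 1` then `[a_1,…,a_d]` is `c`-guaranteed. -/
theorem eps_guaranteed (c d : ℕ) (hc : 1 ≤ c) (hd : 1 ≤ d)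
    (a : Fin d → ℕ) (ha : ∀ i, 2 ≤ a i)
    (ε : ℕ → ℝ) (h0 : ε 0 = 0)
    (hrec : ∀ j : Fin d, ε ((j : ℕ) + 1) =
      2 * ε (j : ℕ) + (c : ℝ) ^ (2 ^ (j : ℕ)) / ((a j : ℝ) - 1))
    (hlt : ε d < 1) :
    Guaranteed d a c 1 := by
  classical
  intro f
  have hcount := (le_coloredBoxCount hc ε h0 d a ha hrec f).2
  have hcard : ∀ i, (0 : ℝ) < Fintype.card (IncPair (a i)) := fun i =>
    Nat.cast_pos.2 (Fintype.card_pos_iff.2 ⟨⟨(⟨0, by have := ha i; omega⟩,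
      ⟨1, by have := ha i; omega⟩), by simp⟩⟩)
  have hc' : (0 : ℝ) < c := by exact_mod_cast hc
  have hpos : 0 < (1 - ε d) * (c * ∏ i, (Fintype.card (IncPair (a i)) : ℝ)) :=
    mul_pos (by linarith) (mul_pos hc' (Finset.prod_pos fun i _ => hcard i))
  have hboxes : 0 < coloredBoxCount f := by
    exact_mod_cast pos_of_mul_pos_right (hpos.trans_le hcount) (by positivity)
  obtain ⟨⟨b, s⟩, hb⟩ := Finset.card_pos.1 hboxes
  have hfin : (monoBoxSet f).Finite := by
    have : Finite (GridPoint d a) := inferInstanceAs (Finite (∀ i, Fin (a i)))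
    exact Set.toFinite _
  exact (Set.ncard_pos hfin).2 ⟨(fun i => (b i).1.1, fun i => (b i).1.2),
    fun i => (b i).2, s, (Finset.mem_filter.1 hb).2⟩
end
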